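/- Let G be a unicyclic graph whose unique cycle is the odd cycle C_{2n+1} = (x_1,…,x_{2n+1}) (n ≥ 1), let I = I(G) be its edge ideal in R, and let c = x_1⋯x_{2n+1}. Then for every integer s ≥ 2(n+1), one has the ideal identity I^{s−(n+1)} ∩ I^{s−2(n+1)}·(c) = I^{s−2(n+1)}·(I^{n+1} ∩ (c)). -/

import Mathlib

open MvPolynomial

noncomputable section

/-- The edge ideal of a simple graph: `I(G) = ⟨X_u · X_v : {u,v} ∈ E(G)⟩`. -/
def edgeIdeal (𝕜 : Type) [Field 𝕜] {V : Type} (G : SimpleGraph V) :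
    Ideal (MvPolynomial V 𝕜) :=
  Ideal.span {p | ∃ u v : V, G.Adj u v ∧ p = X u * X v}

/-- `G` is a unicyclic graph (connected with exactly one cycle, equivalently connected with as
many edges as vertices) whose unique cycle is the odd cycle `C_{2n+1}` on the vertices `x j`. -/
structure IsUnicyclicOddCycle {V : Type} [Fintype V] (G : SimpleGraph V) (n : ℕ)
    (x : ZMod (2 * n + 1) → V) : Prop where
  connected : G.Connected
  edge_count : G.edgeSet.ncard = Fintype.card V
  inj : Function.Injective x
  adj_iff : ∀ i j : ZMod (2 * n + 1), G.Adj (x i) (x j) ↔ (j = i + 1 ∨ i = j + 1)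

/-- `f` is a minimal monomial generator of the monomial ideal `J`: it is a monic monomial
belonging to `J` such that no monic monomial of `J` properly divides it. -/
def IsMinMonomialGen {𝕜 : Type} [Field 𝕜] {V : Type} (J : Ideal (MvPolynomial V 𝕜))
    (f : MvPolynomial V 𝕜) : Prop :=
  (∃ m : V →₀ ℕ, f = monomial m 1) ∧ f ∈ J ∧
    ∀ g : MvPolynomial V 𝕜, (∃ m : V →₀ ℕ, g = monomial m 1) → g ∈ J → g ∣ f → g = f

/-- Exponent vectors of products of `t` edges. -/
def edgeExp {V : Type} (G : SimpleGraph V) : ℕ → Set (V →₀ ℕ)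
  | 0 => {0}
  | t + 1 => {m | ∃ u v a, G.Adj u v ∧ a ∈ edgeExp G t ∧
      m = Finsupp.single u 1 + Finsupp.single v 1 + a}

theorem edgeIdeal_pow_eq (𝕜 : Type) [Field 𝕜] {V : Type} (G : SimpleGraph V) (t : ℕ) :
    (edgeIdeal 𝕜 G) ^ t = Ideal.span ((fun m => monomial m (1 : 𝕜)) '' edgeExp G t) := by
  induction t with
  | zero => simp [edgeExp, Ideal.one_eq_top]
  | succ t ih =>
    rw [pow_succ', ih, edgeIdeal, Ideal.span_mul_span']
    congr 1
    ext p
    simp only [Set.mem_mul, Set.mem_ofPred_eq, Set.mem_image, edgeExp]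
    constructor
    · rintro ⟨_, ⟨u, v, h, rfl⟩, _, ⟨a, ha, rfl⟩, rfl⟩
      refine ⟨_, ⟨u, v, a, h, ha, rfl⟩, ?_⟩
      simp [X, monomial_mul]
    · rintro ⟨_, ⟨u, v, a, h, ha, rfl⟩, rfl⟩
      refine ⟨_, ⟨u, v, h, rfl⟩, _, ⟨a, ha, rfl⟩, ?_⟩
      simp [X, monomial_mul]

theorem edgeExp_mem (𝕜 : Type) [Field 𝕜] {V : Type} (G : SimpleGraph V) {t : ℕ}
    {m : V →₀ ℕ} (h : m ∈ edgeExp G t) : monomial m (1 : 𝕜) ∈ (edgeIdeal 𝕜 G) ^ t := by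
  rw [edgeIdeal_pow_eq]
  exact Ideal.subset_span ⟨m, h, rfl⟩

theorem edgeExp_degree {V : Type} (G : SimpleGraph V) {t : ℕ} :
    ∀ {m : V →₀ ℕ}, m ∈ edgeExp G t → m.degree = 2 * t := by
  induction t with
  | zero => intro m h; simp only [edgeExp, Set.mem_singleton_iff] at h; simp [h]
  | succ t ih =>
    rintro m ⟨u, v, a, -, ha, rfl⟩
    simp [map_add, ih ha]
    ring

/-- An edge product divisible by the vertex `u` contains an edge at `u`. -/
theorem edgeExp_extract {V : Type} (G : SimpleGraph V) {t : ℕ} (u : V) :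
    ∀ {m : V →₀ ℕ}, m ∈ edgeExp G t → m u ≠ 0 →
      ∃ k v a, t = k + 1 ∧ G.Adj u v ∧ a ∈ edgeExp G k ∧
        m = Finsupp.single u 1 + Finsupp.single v 1 + a := by
  induction t with
  | zero => intro m h hu; simp only [edgeExp, Set.mem_singleton_iff] at h; simp [h] at hu
  | succ t ih =>
    rintro m ⟨p, q, a, hpq, ha, rfl⟩ hu
    by_cases hp : p = u
    · subst hp; exact ⟨t, q, a, rfl, hpq, ha, rfl⟩
    by_cases hq : q = u
    · subst hq; exact ⟨t, p, a, rfl, hpq.symm, ha, by abel⟩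
    have hau : a u ≠ 0 := by
      simpa [Finsupp.single_apply, hp, hq] using hu
    obtain ⟨k, v, b, rfl, hv, hb, rfl⟩ := ih ha hau
    exact ⟨k + 1, v, Finsupp.single p 1 + Finsupp.single q 1 + b, rfl, hv,
      ⟨p, q, b, hpq, hb, rfl⟩, by abel⟩

theorem path_mem {V : Type} (G : SimpleGraph V) (y : ℕ → V)
    (h : ∀ k, G.Adj (y k) (y (k + 1))) (m : ℕ) :
    ∑ k ∈ Finset.range (2 * m), Finsupp.single (y k) 1 ∈ edgeExp G m := by
  induction m with
  | zero => simp [edgeExp]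
  | succ m ih =>
    refine ⟨y (2 * m), y (2 * m + 1), _, h _, ih, ?_⟩
    rw [show 2 * (m + 1) = 2 * m + 1 + 1 by ring, Finset.sum_range_succ, Finset.sum_range_succ]
    abel

theorem zmod_sum {M : Type} [AddCommMonoid M] (N : ℕ) [NeZero N] (g : ZMod N → M) :
    ∑ j, g j = ∑ k ∈ Finset.range N, g (k : ZMod N) := by
  symm
  refine Finset.sum_bij (fun k _ => (k : ZMod N)) (fun _ _ => Finset.mem_univ _) ?_ ?_
    (fun _ _ => rfl)
  · intro a ha b hb hab
    have := congrArg ZMod.val hab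
    rwa [ZMod.val_natCast_of_lt (Finset.mem_range.1 ha),
      ZMod.val_natCast_of_lt (Finset.mem_range.1 hb)] at this
  · intro b _
    exact ⟨b.val, Finset.mem_range.2 (ZMod.val_lt b), by simp⟩

theorem cycle_split {V : Type} (G : SimpleGraph V) (n : ℕ)
    (x : ZMod (2 * n + 1) → V) (hx : ∀ i, G.Adj (x i) (x (i + 1))) (i : ZMod (2 * n + 1)) :
    ∃ d ∈ edgeExp G n, ∑ j, Finsupp.single (x j) 1 = Finsupp.single (x i) 1 + d := by
  refine ⟨_, path_mem G (fun k => x (i + ((k + 1 : ℕ) : ZMod (2 * n + 1)))) ?_ n, ?_⟩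
  · intro k
    have := hx (i + ((k + 1 : ℕ) : ZMod (2 * n + 1)))
    rw [add_assoc] at this
    exact_mod_cast this
  · rw [← Equiv.sum_comp (Equiv.addLeft i), zmod_sum, Finset.sum_range_succ']
    simp [add_comm]

theorem core_exchange {V : Type} (𝕜 : Type) [Field 𝕜] (G : SimpleGraph V) (n : ℕ)
    (C : V →₀ ℕ) (hdeg : C.degree = 2 * n + 1)
    (hC : ∀ v, C v ≠ 0 → ∃ d ∈ edgeExp G n, C = Finsupp.single v 1 + d)
    (t : ℕ) : ∀ f w N : V →₀ ℕ, f ∈ edgeExp G t → N ∈ edgeExp G (t + n + 1) →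
      N ≤ C + f + w → monomial (C + f + w) (1 : 𝕜) ∈
        (edgeIdeal 𝕜 G) ^ t * ((edgeIdeal 𝕜 G) ^ (n + 1) ⊓ Ideal.span {monomial C 1}) := by
  induction t using Nat.strong_induction_on with
  | _ t ih =>
  classical
  intro f w N hf hN hle
  -- finishing step: it suffices to find a divisor of `w` carrying `C` into `I^(n+1)`
  have fin : ∀ a b g : V →₀ ℕ, w = a + b → C + a = g → ∀ e ∈ edgeExp G (n + 1), ∀ r, g = e + r →
      monomial (C + f + w) (1 : 𝕜) ∈
        (edgeIdeal 𝕜 G) ^ t * ((edgeIdeal 𝕜 G) ^ (n + 1) ⊓ Ideal.span {monomial C 1}) := by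
    intro a b g hw hg e he r hr
    have h1 : monomial (C + f + w) (1 : 𝕜) =
        monomial b 1 * (monomial f 1 * monomial g 1) := by
      rw [monomial_mul, monomial_mul, one_mul, one_mul, hw, ← hg]
      congr 1
      congr 1
      abel
    rw [h1]
    refine Ideal.mul_mem_left _ _ (Ideal.mul_mem_mul (edgeExp_mem 𝕜 G hf) ⟨?_, ?_⟩)
    · have : monomial g (1 : 𝕜) = monomial r 1 * monomial e 1 := by
        rw [monomial_mul, hr, add_comm e r, one_mul]
      rw [this]
      exact Ideal.mul_mem_left _ _ (edgeExp_mem 𝕜 G he)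
    · refine Ideal.mem_span_singleton.2 ⟨monomial a 1, ?_⟩
      rw [monomial_mul, hg, one_mul]
  have hu : ∃ u, w u ≠ 0 ∧ N u ≠ 0 := by
    by_contra! hcon
    have hle' : N ≤ C + f := by
      intro v
      have h1 := hle v
      have h2 := hcon v
      simp only [Finsupp.add_apply] at h1 ⊢
      by_cases hw : w v = 0
      · omega
      · have := h2 hw
        omega
    have h3 := Finsupp.degree_mono hle'
    rw [map_add, edgeExp_degree G hN, edgeExp_degree G hf, hdeg] at h3
    omega
  obtain ⟨u, hwu, hNu⟩ := hu
  obtain ⟨k, v, N1, hk, huv, hN1, rfl⟩ := edgeExp_extract G u hN hNu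
  obtain rfl : k = t + n := by omega
  have hwsplit : w = Finsupp.single u 1 + (w - Finsupp.single u 1) := by
    rw [add_tsub_cancel_of_le]
    rw [Finsupp.single_le_iff]; omega
  by_cases hCv : C v ≠ 0
  · obtain ⟨d, hd, hCd⟩ := hC v hCv
    refine fin _ _ _ hwsplit rfl (Finsupp.single v 1 + Finsupp.single u 1 + d)
      ⟨v, u, d, huv.symm, hd, rfl⟩ 0 ?_
    rw [hCd]; abel
  by_cases hfv : f v ≠ 0
  · obtain ⟨k, z, f1, rfl, hvz, hf1, rfl⟩ := edgeExp_extract G v hf hfv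
    have key := ih k (by omega) f1 (Finsupp.single z 1 + (w - Finsupp.single u 1)) N1 hf1
      (by rwa [show k + n + 1 = k + 1 + n by ring]) (by
        intro y
        have h1 := hle y
        rw [hwsplit] at h1
        simp only [Finsupp.add_apply] at h1 ⊢
        omega)
    rw [pow_succ', mul_assoc]
    have h2 : monomial (C + (Finsupp.single v 1 + Finsupp.single z 1 + f1) + w) (1 : 𝕜) =
        (X u * X v) * monomial (C + f1 + (Finsupp.single z 1 + (w - Finsupp.single u 1))) 1 := by
      rw [X, X, monomial_mul, monomial_mul, one_mul, one_mul]
      conv_lhs => rw [hwsplit]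
      congr 2
      ext y
      simp only [Finsupp.add_apply]
      omega
    rw [h2]
    exact Ideal.mul_mem_mul (Ideal.subset_span ⟨u, v, huv, rfl⟩) key
  · push Not at hCv hfv
    have hne := huv.ne
    have hwv : w v ≠ 0 := by
      have h1 := hle v
      simp [hCv, hfv] at h1
      omega
    have hw2 : w = (Finsupp.single u 1 + Finsupp.single v 1) +
        (w - (Finsupp.single u 1 + Finsupp.single v 1)) := by
      rw [add_tsub_cancel_of_le]
      intro y
      simp only [Finsupp.add_apply, Finsupp.single_apply]
      split_ifs with h1 h2 h2
      · exact absurd (h1.trans h2.symm) hne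
      · subst h1; omega
      · subst h2; omega
      · omega
    obtain ⟨v0, hv0⟩ : ∃ v0, C v0 ≠ 0 := by
      by_contra! hcon
      have : C = 0 := Finsupp.ext hcon
      simp [this] at hdeg
    obtain ⟨d, hd, hCd⟩ := hC v0 hv0
    refine fin _ _ _ hw2 rfl (Finsupp.single u 1 + Finsupp.single v 1 + d)
      ⟨u, v, d, huv, hd, rfl⟩ (Finsupp.single v0 1) ?_
    rw [hCd]; abel

/-- for the edge ideal `I` of a unicyclic graph with unique odd cycle `C_{2n+1}`
and `c = x_1 ⋯ x_{2n+1}`, for all `s ≥ 2(n+1)` one has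
`I^{s-(n+1)} ∩ I^{s-2(n+1)}·(c) = I^{s-2(n+1)}·(I^{n+1} ∩ (c))`. -/
theorem unicyclic_intersection_identity {V : Type} [Fintype V] (𝕜 : Type) [Field 𝕜]
    (G : SimpleGraph V) (n : ℕ) (hn : 1 ≤ n)
    (x : ZMod (2 * n + 1) → V) (hx : IsUnicyclicOddCycle G n x)
    (c : MvPolynomial V 𝕜) (hc : c = ∏ j : ZMod (2 * n + 1), X (x j))
    (s : ℕ) (hs : 2 * (n + 1) ≤ s) :
    (edgeIdeal 𝕜 G) ^ (s - (n + 1)) ⊓ ((edgeIdeal 𝕜 G) ^ (s - 2 * (n + 1)) * Ideal.span {c}) =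
      (edgeIdeal 𝕜 G) ^ (s - 2 * (n + 1)) *
        ((edgeIdeal 𝕜 G) ^ (n + 1) ⊓ Ideal.span {c}) := by
  classical
  set C : V →₀ ℕ := ∑ j : ZMod (2 * n + 1), Finsupp.single (x j) 1 with hCdef
  have hcC : c = monomial C 1 := by
    rw [hc, hCdef, monomial_sum_one]
    rfl
  have hadj : ∀ i, G.Adj (x i) (x (i + 1)) := fun i => (hx.adj_iff _ _).2 (Or.inl rfl)
  have hdeg : C.degree = 2 * n + 1 := by
    rw [hCdef, map_sum]
    simp [ZMod.card]
  have hC : ∀ v, C v ≠ 0 → ∃ d ∈ edgeExp G n, C = Finsupp.single v 1 + d := by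
    intro v hv
    rw [hCdef, Finsupp.finsetSum_apply] at hv
    obtain ⟨i, -, hi⟩ := Finset.exists_ne_zero_of_sum_ne_zero hv
    have : x i = v := by
      by_contra hne
      exact hi (by simp [hne])
    subst this
    exact cycle_split G n x hadj i
  obtain ⟨t, rfl⟩ : ∃ t, s = t + 2 * (n + 1) := ⟨s - 2 * (n + 1), by omega⟩
  rw [show t + 2 * (n + 1) - (n + 1) = t + n + 1 by omega, Nat.add_sub_cancel, hcC]
  apply le_antisymm
  · rintro p ⟨hp1, hp2⟩
    have hprod : (edgeIdeal 𝕜 G) ^ t * Ideal.span {monomial C (1 : 𝕜)} =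
        Ideal.span ((fun m => monomial m (1 : 𝕜)) '' ((fun f => C + f) '' edgeExp G t)) := by
      rw [edgeIdeal_pow_eq, Ideal.span_mul_span']
      congr 1
      ext q
      simp [Set.mem_mul, monomial_mul, add_comm]
    change p ∈ (edgeIdeal 𝕜 G) ^ (t + n + 1) at hp1
    change p ∈ (edgeIdeal 𝕜 G) ^ t * Ideal.span {monomial C (1 : 𝕜)} at hp2
    rw [edgeIdeal_pow_eq, mem_ideal_span_monomial_image] at hp1
    rw [hprod, mem_ideal_span_monomial_image] at hp2
    rw [p.as_sum]
    refine Ideal.sum_mem _ fun m hm => ?_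
    obtain ⟨N, hN, hNm⟩ := hp1 m hm
    obtain ⟨_, ⟨f, hf, rfl⟩, hfm⟩ := hp2 m hm
    obtain ⟨w, rfl⟩ := exists_add_of_le hfm
    have := core_exchange 𝕜 G n C hdeg hC t f w N hf hN hNm
    have h2 := Ideal.mul_mem_left _ (MvPolynomial.C (coeff (C + f + w) p)) this
    rwa [C_mul_monomial, mul_one] at h2
  · refine le_inf ?_ (Ideal.mul_mono_right inf_le_right)
    have h3 : (edgeIdeal 𝕜 G) ^ (t + n + 1) =
        (edgeIdeal 𝕜 G) ^ t * (edgeIdeal 𝕜 G) ^ (n + 1) := by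
      rw [← pow_add, add_assoc]
    rw [h3]
    exact Ideal.mul_mono_right inf_le_left

end
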